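/- arXiv:1306.5641 — 6 statements merged into one kernel-verified Lean document; each statement's English description precedes it below -/
import Mathlib

section
/- Let m, g, R, I₃ be positive reals, 0 < α < 1, and let γ satisfy 1 − α² < γ < 1 + α. Define λ_thres = √(m g R³ α I₃)·(1+α)²/√(1+α−γ) and λ_up = √(m g R³ α I₃)·(1−α)²/√(α+γ−1). Then λ_thres > λ_up. -/
/-- For Tippe Top parameters `m, g, R, I₃ > 0`, `0 < α < 1` and
`1 − α² < γ < 1 + α`, the threshold value
`λ_thres = √(m g R³ α I₃)·(1+α)²/√(1+α−γ)` exceeds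
`λ_up = √(m g R³ α I₃)·(1−α)²/√(α+γ−1)`. -/
theorem stmt_0 (m g R I₃ α γ : ℝ)
    (hm : 0 < m) (hg : 0 < g) (hR : 0 < R) (hI₃ : 0 < I₃)
    (hα0 : 0 < α) (hα1 : α < 1)
    (hγ1 : 1 - α ^ 2 < γ) (hγ2 : γ < 1 + α) :
    Real.sqrt (m * g * R ^ 3 * α * I₃) * (1 + α) ^ 2 / Real.sqrt (1 + α - γ) >
      Real.sqrt (m * g * R ^ 3 * α * I₃) * (1 - α) ^ 2 / Real.sqrt (α + γ - 1) := by
  have hx : 0 < 1 + α - γ := by linarith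
  have hy : 0 < α + γ - 1 := by nlinarith
  have hα : 0 < 1 - α := by linarith
  have hS : 0 < Real.sqrt (m * g * R ^ 3 * α * I₃) := Real.sqrt_pos.2 (by positivity)
  have hcube : (1 - α) ^ 3 < (1 + α) ^ 3 := by
    gcongr
    linarith
  have key : ((1 - α) ^ 2) ^ 2 * (1 + α - γ) < ((1 + α) ^ 2) ^ 2 * (α + γ - 1) :=
    calc ((1 - α) ^ 2) ^ 2 * (1 + α - γ)
        < ((1 - α) ^ 2) ^ 2 * (α * (1 + α)) := by
          gcongr
          linarith
      _ = (1 - α) ^ 3 * (α * (1 + α) * (1 - α)) := by ring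
      _ < (1 + α) ^ 3 * (α * (1 + α) * (1 - α)) := by gcongr
      _ = ((1 + α) ^ 2) ^ 2 * (α * (1 - α)) := by ring
      _ < ((1 + α) ^ 2) ^ 2 * (α + γ - 1) := by
          gcongr
          linarith
  have hsqrt : (1 - α) ^ 2 * Real.sqrt (1 + α - γ) < (1 + α) ^ 2 * Real.sqrt (α + γ - 1) := by
    refine lt_of_pow_lt_pow_left₀ 2 (by positivity) ?_
    rwa [mul_pow, mul_pow, Real.sq_sqrt hx.le, Real.sq_sqrt hy.le]
  rw [gt_iff_lt, div_lt_div_iff₀ (Real.sqrt_pos.2 hy) (Real.sqrt_pos.2 hx)]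
  simpa only [mul_assoc] using mul_lt_mul_of_pos_left hsqrt hS
end

section
/- Let m, g, R, I₁, I₃ be positive reals, 0 < α < 1, γ = I₁/I₃, σ = mR²/I₃, and assume 1 − α² < γ < 1 and σ = (1−α)/(γ+α²−1). Let λ > λ_thres = √(m g R³ α I₃)(1+α)²/√(1+α−γ) and set D₁ = −λ√(d(−1))/(R(1+α)). Then for every ε > 0 there exists δ₋ > 0 such that for every δ with 0 < δ < δ₋, the function z ↦ V(z, D, λ) on (−1,1), with D = D₁ + δ/(R(1+α)√(γ+α²−1)), has a local minimum point z_min lying in the interval (−1, −1+ε]. -/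
open Real

/-- The function `d(z) = γ + σ(α−z)² + σγ(1−z²)`. -/
noncomputable def dTT (γ σ α z : ℝ) : ℝ := γ + σ * (α - z) ^ 2 + σ * γ * (1 - z ^ 2)

/-- The effective potential
`V(z, D, λ) = mgR(1−αz) + (λ√(d(z)) + R·D·(α−z))²/(2 I₃ R² γ² (1−z²)) + (R²D² − σλ²)/(2R²I₁)`. -/
noncomputable def VTT (m g R I₁ I₃ γ σ α lam D z : ℝ) : ℝ :=
  m * g * R * (1 - α * z)
    + (lam * Real.sqrt (dTT γ σ α z) + R * D * (α - z)) ^ 2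
        / (2 * I₃ * R ^ 2 * γ ^ 2 * (1 - z ^ 2))
    + (R ^ 2 * D ^ 2 - σ * lam ^ 2) / (2 * R ^ 2 * I₁)

open Filter Topology

/-- A continuous function on `[p, y]` that is smaller at an interior point than at both ends has
a local minimum inside. -/
theorem exists_isLocalMin_of_lt_of_lt {h : ℝ → ℝ} {p w y : ℝ} (hpw : p < w) (hwy : w < y)
    (hc : ContinuousOn h (Set.Icc p y)) (hp : h w < h p) (hy : h w < h y) :
    ∃ z ∈ Set.Ioo p y, IsLocalMin h z := by
  have hw : w ∈ Set.Icc p y := ⟨hpw.le, hwy.le⟩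
  obtain ⟨z, hz, hmin⟩ := isCompact_Icc.exists_isMinOn ⟨w, hw⟩ hc
  have hzw : h z ≤ h w := hmin hw
  have hzp : p < z := lt_of_le_of_ne hz.1 fun e => by subst e; linarith
  have hzy : z < y := lt_of_le_of_ne hz.2 fun e => by subst e; linarith
  exact ⟨z, ⟨hzp, hzy⟩, hmin.isLocalMin (Icc_mem_nhds hzp hzy)⟩

/-- If `f` vanishes at `-1` with slope `k`, `k² > 4BA`, then the perturbed potential
`a - A z + (f z + δ q z)² / (2B(1 - z²))` has, for small `δ > 0`, a local minimum near `-1`. -/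
theorem exists_isLocalMin_perturbed {f q : ℝ → ℝ} {k A B a : ℝ} (hf : Continuous f)
    (hq : Continuous q) (hfk : HasDerivAt f k (-1)) (hf0 : f (-1) = 0) (hq0 : 0 < q (-1))
    (hB : 0 < B) (hk : 4 * B * A < k ^ 2) {ε : ℝ} (hε : 0 < ε) :
    ∃ δm > 0, ∀ δ, 0 < δ → δ < δm → ∃ z ∈ Set.Ioo (-1 : ℝ) (-1 + ε),
      IsLocalMin (fun z => a - A * z + (f z + δ * q z) ^ 2 / (2 * B * (1 - z ^ 2))) z := by
  set U : ℝ → ℝ → ℝ := fun δ z => a - A * z + (f z + δ * q z) ^ 2 / (2 * B * (1 - z ^ 2)) with hU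
  have hslope : Tendsto (slope f (-1)) (𝓝[>] (-1)) (𝓝 k) :=
    (hasDerivAt_iff_tendsto_slope.1 hfk).mono_left
      (nhdsWithin_mono _ fun x hx => ne_of_gt hx)
  have hfs : ∀ z, f z = (z + 1) * slope f (-1) z := by
    intro z
    have := sub_smul_slope f (-1) z
    simp only [smul_eq_mul, vsub_eq_sub, hf0] at this
    linarith
  obtain ⟨y, hy1, hyε, hy0, hyU⟩ : ∃ y, -1 < y ∧ y < -1 + ε ∧ y < 0 ∧ a + A < U 0 y := by
    have hid : Tendsto (fun z : ℝ => z) (𝓝[>] (-1)) (𝓝 (-1)) := nhdsWithin_le_nhds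
    have h1 : Tendsto (fun z => 2 * B * A * (1 - z)) (𝓝[>] (-1)) (𝓝 (2 * B * A * (1 - -1))) :=
      (hid.const_sub 1).const_mul _
    have h2 := h1.eventually_lt (hslope.pow 2) (by linarith)
    have h3 : ∀ᶠ z in 𝓝[>] (-1 : ℝ), z < -1 + ε := hid.eventually_lt_const (by linarith)
    have h4 : ∀ᶠ z in 𝓝[>] (-1 : ℝ), z < 0 := hid.eventually_lt_const (by linarith)
    obtain ⟨y, h2, h3, h4, h5⟩ := (h2.and (h3.and (h4.and self_mem_nhdsWithin))).exists
    have hy1 : -1 < y := h5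
    refine ⟨y, hy1, h3, h4, ?_⟩
    have hyp : 0 < 1 + y := by linarith
    have : A * (1 + y) < (f y) ^ 2 / (2 * B * (1 - y ^ 2)) := by
      rw [lt_div_iff₀ (mul_pos (by positivity) (by nlinarith)), hfs]
      have := mul_lt_mul_of_pos_left h2 (pow_pos hyp 2)
      linarith
    simp only [hU, zero_mul, add_zero]
    linarith
  have hlimy : Tendsto (fun δ => U δ y) (𝓝[>] 0) (𝓝 (U 0 y)) := by
    have : Continuous fun δ => U δ y := by simp only [hU]; fun_prop
    exact this.continuousAt.tendsto.mono_left nhdsWithin_le_nhds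
  have hid0 : Tendsto (fun δ : ℝ => δ) (𝓝[>] 0) (𝓝 0) := nhdsWithin_le_nhds
  have hadd : Tendsto (fun δ : ℝ => -1 + δ) (𝓝[>] 0) (𝓝 (-1)) := by
    simpa using hid0.const_add (-1)
  have hlimw : Tendsto (fun δ => U δ (-1 + δ)) (𝓝[>] 0) (𝓝 (a + A)) := by
    have hs : Tendsto (fun δ : ℝ => slope f (-1) (-1 + δ)) (𝓝[>] 0) (𝓝 k) := by
      refine hslope.comp (tendsto_nhdsWithin_iff.2 ⟨hadd, ?_⟩)
      filter_upwards [self_mem_nhdsWithin] with δ hδ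
      have : 0 < δ := hδ
      simp [this]
    have hq' : Tendsto (fun δ : ℝ => q (-1 + δ)) (𝓝[>] 0) (𝓝 (q (-1))) :=
      (hq.tendsto _).comp hadd
    have hlim : Tendsto (fun δ : ℝ => a - A * (-1 + δ) +
        δ * (slope f (-1) (-1 + δ) + q (-1 + δ)) ^ 2 / (2 * B * (2 - δ))) (𝓝[>] 0)
        (𝓝 (a - A * (-1) + 0 * (k + q (-1)) ^ 2 / (2 * B * (2 - 0)))) :=
      ((hadd.const_mul A).const_sub a).add
        ((hid0.mul ((hs.add hq').pow 2)).div ((hid0.const_sub 2).const_mul (2 * B))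
          (by simp [hB.ne']))
    have e : a - A * (-1) + 0 * (k + q (-1)) ^ 2 / (2 * B * (2 - 0)) = a + A := by ring
    rw [e] at hlim
    refine hlim.congr' ?_
    filter_upwards [self_mem_nhdsWithin] with δ hδ
    have hδ : 0 < δ := hδ
    simp only [hU]
    rw [hfs (-1 + δ)]
    have e1 : (-1 + δ + 1) * slope f (-1) (-1 + δ) + δ * q (-1 + δ)
        = δ * (slope f (-1) (-1 + δ) + q (-1 + δ)) := by ring
    have e2 : 2 * B * (1 - (-1 + δ) ^ 2) = δ * (2 * B * (2 - δ)) := by ring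
    rw [e1, e2, mul_pow, sq δ, mul_assoc δ δ, mul_div_mul_left _ _ hδ.ne']
  have hev := hlimw.eventually_lt hlimy hyU
  have hevy : ∀ᶠ δ in 𝓝[>] (0 : ℝ), -1 + δ < y := hadd.eventually_lt_const hy1
  obtain ⟨δm, hδm, hsub⟩ := mem_nhdsGT_iff_exists_Ioo_subset.1 (hev.and hevy)
  refine ⟨δm, hδm, fun δ hδ hδlt => ?_⟩
  obtain ⟨hwU, hwy⟩ := hsub ⟨hδ, hδlt⟩
  have hblow : Tendsto (U δ) (𝓝[>] (-1)) atTop := by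
    have hnum : Tendsto (fun z => (f z + δ * q z) ^ 2) (𝓝[>] (-1)) (𝓝 ((δ * q (-1)) ^ 2)) := by
      have : Continuous fun z => (f z + δ * q z) ^ 2 := by fun_prop
      have := (this.tendsto (-1)).mono_left (nhdsWithin_le_nhds (s := Set.Ioi (-1)))
      simpa [hf0] using this
    have hden : Tendsto (fun z : ℝ => 2 * B * (1 - z ^ 2)) (𝓝[>] (-1)) (𝓝[>] 0) := by
      refine tendsto_nhdsWithin_iff.2 ⟨?_, ?_⟩
      · have : Continuous fun z : ℝ => 2 * B * (1 - z ^ 2) := by fun_prop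
        have := (this.tendsto (-1)).mono_left (nhdsWithin_le_nhds (s := Set.Ioi (-1)))
        simpa using this
      · filter_upwards [Ioo_mem_nhdsGT (show (-1 : ℝ) < 0 by norm_num)] with z hz
        exact Set.mem_Ioi.2 (mul_pos (by positivity) (by nlinarith [hz.1, hz.2]))
    have hlin : Tendsto (fun z : ℝ => a - A * z) (𝓝[>] (-1)) (𝓝 (a - A * (-1))) :=
      (Continuous.tendsto (by fun_prop) _).mono_left nhdsWithin_le_nhds
    refine hlin.add_atTop ?_
    simp only [div_eq_mul_inv]
    exact hnum.pos_mul_atTop (by positivity) (tendsto_inv_nhdsGT_zero.comp hden)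
  obtain ⟨p, hpU, hp1, hpw⟩ := ((hblow.eventually_gt_atTop (U δ (-1 + δ))).and
    (Ioo_mem_nhdsGT (show (-1 : ℝ) < -1 + δ by linarith))).exists
  have hcont : ContinuousOn (U δ) (Set.Icc p y) := by
    refine ContinuousOn.add (by fun_prop) (ContinuousOn.div (by fun_prop) (by fun_prop) ?_)
    intro z hz
    exact (mul_pos (by positivity) (by nlinarith [hz.1, hz.2])).ne'
  obtain ⟨z, hz, hmin⟩ := exists_isLocalMin_of_lt_of_lt hpw hwy hcont hpU hwU
  exact ⟨z, ⟨hp1.trans hz.1, hz.2.trans hyε⟩, hmin⟩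

/-- Above the threshold, the slope of `λ√d(z) + R D₁ (α - z)` at `-1` dominates gravity. -/
theorem threshold_slope_bound {m g R I₃ α γ σ lam d : ℝ}
    (hm : 0 < m) (hg : 0 < g) (hR : 0 < R) (hI₃ : 0 < I₃) (hα0 : 0 < α)
    (hγ0 : 0 < γ) (hc : 0 < γ + α ^ 2 - 1) (hγ2 : γ < 1)
    (hrat : σ = (1 - α) / (γ + α ^ 2 - 1)) (hd : d = γ + σ * (1 + α) ^ 2) (hd0 : 0 < d)
    (hlam : lam > √(m * g * R ^ 3 * α * I₃) * (1 + α) ^ 2 / √(1 + α - γ)) :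
    4 * (I₃ * R ^ 2 * γ ^ 2) * (m * g * R * α)
      < (lam * (γ * (1 + σ * (1 + α))) / (√d * (1 + α))) ^ 2 := by
  set c := γ + α ^ 2 - 1 with hcdef
  set M := m * g * R ^ 3 * α * I₃ with hM
  have hM0 : 0 < M := by positivity
  have hs : 0 < 1 + α - γ := by linarith
  have hlam2 : M * (1 + α) ^ 4 / (1 + α - γ) < lam ^ 2 := by
    have := pow_lt_pow_left₀ hlam (by positivity) (two_ne_zero)
    rw [div_pow, mul_pow, sq_sqrt hM0.le, sq_sqrt hs.le] at this
    rwa [← pow_mul] at this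
  have hσ1 : 1 + σ * (1 + α) = γ / c := by
    rw [hrat]; field_simp; rw [hcdef]; ring
  have hcd : c * d = γ * c + (1 - α) * (1 + α) ^ 2 := by
    rw [hd, hrat]; field_simp
  have hamgm : 4 * (c * (1 + α - γ)) * (c * d) ≤ ((1 + α) * γ) ^ 2 := by
    have : c * (1 + α - γ) = (1 + α) * γ - c * d := by rw [hcd, hcdef]; ring
    rw [this]
    nlinarith [sq_nonneg ((1 + α) * γ - 2 * (c * d))]
  rw [hσ1, div_pow, mul_pow, mul_pow √d, sq_sqrt hd0.le, lt_div_iff₀ (by positivity)]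
  rw [div_lt_iff₀ hs] at hlam2
  have e : lam ^ 2 * (γ * (γ / c)) ^ 2 = lam ^ 2 * γ ^ 4 / c ^ 2 := by field_simp
  rw [e, lt_div_iff₀ (by positivity)]
  have e2 : 4 * (I₃ * R ^ 2 * γ ^ 2) * (m * g * R * α) * (d * (1 + α) ^ 2) * c ^ 2
      = γ ^ 2 * M * (1 + α) ^ 2 * (4 * c * (c * d)) := by rw [hM]; ring
  rw [e2]
  refine lt_of_mul_lt_mul_right ?_ hs.le
  calc γ ^ 2 * M * (1 + α) ^ 2 * (4 * c * (c * d)) * (1 + α - γ)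
      = γ ^ 2 * M * (1 + α) ^ 2 * (4 * (c * (1 + α - γ)) * (c * d)) := by ring
    _ ≤ γ ^ 2 * M * (1 + α) ^ 2 * ((1 + α) * γ) ^ 2 := by gcongr
    _ = γ ^ 4 * (M * (1 + α) ^ 4) := by ring
    _ < γ ^ 4 * (lam ^ 2 * (1 + α - γ)) := by gcongr
    _ = lam ^ 2 * γ ^ 4 * (1 + α - γ) := by ring

theorem hasDerivAt_dTT (γ σ α z : ℝ) :
    HasDerivAt (dTT γ σ α) (-2 * σ * (α - z) - 2 * σ * γ * z) z := by
  have h1 := ((((hasDerivAt_id z).const_sub α).pow 2).const_mul σ).const_add γ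
  have h2 := (((hasDerivAt_id z).pow 2).const_sub 1).const_mul (σ * γ)
  refine (h1.add h2).congr_deriv ?_
  simp
  ring

/-- Under the rationality conditions `1 − α² < γ < 1`,
`σ = (1−α)/(γ+α²−1)` and for `λ > λ_thres`, for every `ε > 0` there is a
`δm > 0` such that for all `0 < δ < δm` the potential `z ↦ V(z, D, λ)` with
`D = D₁ + δ/(R(1+α)√(γ+α²−1))`, `D₁ = −λ√(d(−1))/(R(1+α))`, has a local
minimum point `z_min ∈ (−1, −1+ε]` on the interval `(−1, 1)`. -/
theorem stmt_1 (m g R I₁ I₃ α γ σ lam : ℝ)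
    (hm : 0 < m) (hg : 0 < g) (hR : 0 < R) (hI₁ : 0 < I₁) (hI₃ : 0 < I₃)
    (hα0 : 0 < α) (hα1 : α < 1)
    (hγ : γ = I₁ / I₃) (hσ : σ = m * R ^ 2 / I₃)
    (hγ1 : 1 - α ^ 2 < γ) (hγ2 : γ < 1)
    (hrat : σ = (1 - α) / (γ + α ^ 2 - 1))
    (hlam : lam > Real.sqrt (m * g * R ^ 3 * α * I₃) * (1 + α) ^ 2
        / Real.sqrt (1 + α - γ)) :
    ∀ ε > 0, ∃ δm > 0, ∀ δ, 0 < δ → δ < δm →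
      ∃ zmin ∈ Set.Ioc (-1 : ℝ) (-1 + ε),
        IsLocalMinOn
          (fun z => VTT m g R I₁ I₃ γ σ α lam
            (-(lam * Real.sqrt (dTT γ σ α (-1))) / (R * (1 + α))
              + δ / (R * (1 + α) * Real.sqrt (γ + α ^ 2 - 1))) z)
          (Set.Ioo (-1 : ℝ) 1) zmin := by
  intro ε hε
  have hγ0 : 0 < γ := hγ ▸ div_pos hI₁ hI₃
  have hc : 0 < γ + α ^ 2 - 1 := by linarith
  have hσ0 : 0 < σ := by rw [hσ]; positivity
  have hd : dTT γ σ α (-1) = γ + σ * (1 + α) ^ 2 := by unfold dTT; ring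
  have hd0 : 0 < dTT γ σ α (-1) := by rw [hd]; positivity
  have hk := threshold_slope_bound hm hg hR hI₃ hα0 hγ0 hc hγ2 hrat hd hd0 hlam
  have hsd : 0 < √(dTT γ σ α (-1)) := sqrt_pos.2 hd0
  have hsq : √(dTT γ σ α (-1)) ^ 2 = γ + σ * (1 + α) ^ 2 := by rw [sq_sqrt hd0.le, hd]
  have hsc : 0 < √(γ + α ^ 2 - 1) := sqrt_pos.2 hc
  set s := √(dTT γ σ α (-1)) with hs
  set r := √(γ + α ^ 2 - 1) with hr
  have hderiv : HasDerivAt (fun z => lam * √(dTT γ σ α z) - lam * s / (1 + α) * (α - z))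
      (lam * (γ * (1 + σ * (1 + α))) / (s * (1 + α))) (-1) := by
    have h1 := ((hasDerivAt_dTT γ σ α (-1)).sqrt hd0.ne').const_mul lam
    have h2 := ((hasDerivAt_id (-1 : ℝ)).const_sub α).const_mul (lam * s / (1 + α))
    refine (h1.sub h2).congr_deriv ?_
    rw [← hs]
    field_simp
    rw [hsq]
    ring
  have hdc : Continuous (dTT γ σ α) :=
    continuous_iff_continuousAt.2 fun z => (hasDerivAt_dTT γ σ α z).continuousAt
  obtain ⟨δm, hδm, H⟩ := exists_isLocalMin_perturbed (q := fun z => (α - z) / ((1 + α) * r))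
    (a := m * g * R) (by fun_prop) (by fun_prop) hderiv
    (by rw [← hs]; field_simp; ring) (div_pos (by linarith) (by positivity))
    (by positivity) hk hε
  refine ⟨δm, hδm, fun δ hδ hδlt => ?_⟩
  obtain ⟨z, hz, hmin⟩ := H δ hδ hδlt
  refine ⟨z, ⟨hz.1, hz.2.le⟩, IsLocalMin.on ?_ _⟩
  refine (hmin.add (isLocalMin_const (b := (R ^ 2 * (-(lam * s) / (R * (1 + α))
    + δ / (R * (1 + α) * r)) ^ 2 - σ * lam ^ 2) / (2 * R ^ 2 * I₁)))).congr ?_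
  refine Filter.Eventually.of_forall fun x => ?_
  have e : lam * √(dTT γ σ α x) - lam * s / (1 + α) * (α - x) + δ * ((α - x) / ((1 + α) * r))
      = lam * √(dTT γ σ α x)
        + R * (-(lam * s) / (R * (1 + α)) + δ / (R * (1 + α) * r)) * (α - x) := by
    field_simp
    ring
  simp only [VTT]
  rw [e]
  ring
end

section
/- Let m, g, R, I₁, I₃ be positive reals, 0 < α < 1, γ = I₁/I₃, σ = mR²/I₃, and assume 1 − α² < γ < 1 and σ = (1−α)/(γ+α²−1). Let λ > λ_thres = √(m g R³ α I₃)(1+α)²/√(1+α−γ) and set D₀ = λ√(d(1))/(R(1−α)). Then for every ε > 0 there exists δ₊ > 0 such that for every δ with 0 < δ < δ₊, the function z ↦ V(z, D, λ) on (−1,1), with D = D₀ − δ/(R(1−α)√(γ+α²−1)), has a local minimum point z_min lying in the interval [1−ε, 1). -/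
open Real

open Filter Topology

/-- A continuous function on `[a, c)` that blows up at `c` and takes a value below `f a` has a
local minimum in `(a, c)`. -/
theorem exists_isLocalMin_mem_Ioo_of_tendsto_atTop {f : ℝ → ℝ} {a b c : ℝ}
    (hb : b ∈ Set.Ioo a c) (hf : ContinuousOn f (Set.Ico a c))
    (hlim : Tendsto f (𝓝[<] c) atTop) (hba : f b < f a) :
    ∃ z ∈ Set.Ioo a c, IsLocalMin f z := by
  obtain ⟨e, hfe, hbe, hec⟩ : ∃ e, f b < f e ∧ e ∈ Set.Ioo b c :=
    ((hlim.eventually_gt_atTop (f b)).and (Ioo_mem_nhdsLT hb.2)).exists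
  obtain ⟨z, hz, hmin⟩ := isCompact_Icc.exists_isMinOn
    ⟨b, hb.1.le, hbe.le⟩ (hf.mono (Set.Icc_subset_Ico_right hec))
  have hzb : f z ≤ f b := hmin ⟨hb.1.le, hbe.le⟩
  have hza : a < z := hz.1.lt_of_ne (by rintro rfl; linarith)
  have hze : z < e := hz.2.lt_of_ne (by rintro rfl; linarith)
  exact ⟨z, ⟨hza, hze.trans hec⟩, hmin.isLocalMin (Icc_mem_nhds hza hze)⟩

/-- If `F` is differentiable at `1` and `F 1 = 0`, then `F² / (C (1 - z²))` vanishes at `1`. -/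
theorem HasDerivAt.tendsto_sq_div_one_sub_sq {F : ℝ → ℝ} {F' : ℝ} (hF : HasDerivAt F F' 1)
    (h0 : F 1 = 0) (C : ℝ) :
    Tendsto (fun z => F z ^ 2 / (C * (1 - z ^ 2))) (𝓝[<] 1) (𝓝 0) := by
  have hslope : Tendsto (slope F 1) (𝓝[<] 1) (𝓝 F') :=
    hF.tendsto_slope.mono_left (nhdsWithin_mono _ fun x hx => ne_of_lt hx)
  have hfac : Tendsto (fun z : ℝ => (1 - z) / (1 + z) / C) (𝓝[<] 1) (𝓝 0) := by
    have : ContinuousAt (fun z : ℝ => (1 - z) / (1 + z) / C) 1 :=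
      ContinuousAt.div_const (ContinuousAt.div (by fun_prop) (by fun_prop) (by norm_num)) C
    simpa using this.tendsto.mono_left nhdsWithin_le_nhds
  have hprod := (hslope.pow 2).mul hfac
  rw [mul_zero] at hprod
  refine hprod.congr' ?_
  filter_upwards [Ioo_mem_nhdsLT (show (0 : ℝ) < 1 by norm_num)] with z hz
  have h1 : z - 1 ≠ 0 := by linarith [hz.2]
  have h2 : 1 + z ≠ 0 := by linarith [hz.1]
  have h3 : 1 - z ≠ 0 := by linarith [hz.2]
  rw [slope_def_field, h0, sub_zero, show 1 - z ^ 2 = (1 - z) * (1 + z) by ring]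
  rcases eq_or_ne C 0 with rfl | hC
  · simp
  · field_simp
    ring

/-- If `F` is continuous and nonzero at `1`, then `F² / (C (1 - z²))` blows up at `1` from the
left. -/
theorem ContinuousAt.tendsto_sq_div_one_sub_sq {F : ℝ → ℝ} (hF : ContinuousAt F 1)
    (h0 : F 1 ≠ 0) {C : ℝ} (hC : 0 < C) :
    Tendsto (fun z => F z ^ 2 / (C * (1 - z ^ 2))) (𝓝[<] 1) atTop := by
  have hden : Tendsto (fun z : ℝ => C * (1 - z ^ 2)) (𝓝[<] 1) (𝓝[>] 0) := by
    refine tendsto_nhdsWithin_iff.2 ⟨?_, ?_⟩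
    · have : ContinuousAt (fun z : ℝ => C * (1 - z ^ 2)) 1 := by fun_prop
      simpa using this.tendsto.mono_left nhdsWithin_le_nhds
    · filter_upwards [Ioo_mem_nhdsLT (show (0 : ℝ) < 1 by norm_num)] with z hz
      exact mul_pos hC (by nlinarith [hz.1, hz.2])
  have hnum : Tendsto (fun z => F z ^ 2) (𝓝[<] 1) (𝓝 (F 1 ^ 2)) :=
    (hF.pow 2).tendsto.mono_left nhdsWithin_le_nhds
  simp only [div_eq_mul_inv]
  exact hnum.pos_mul_atTop (by positivity) hden.inv_tendsto_nhdsGT_zero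

theorem continuous_dTT (γ σ α : ℝ) : Continuous (dTT γ σ α) := by
  unfold dTT
  fun_prop

theorem continuousOn_VTT (m g I₁ γ σ α lam D : ℝ) {R I₃ : ℝ} (hR : 0 < R) (hI₃ : 0 < I₃)
    (hγ : 0 < γ) : ContinuousOn (VTT m g R I₁ I₃ γ σ α lam D) (Set.Ico 0 1) := by
  have hd := continuous_dTT γ σ α
  unfold VTT
  refine ContinuousOn.add (ContinuousOn.add (by fun_prop) ?_) continuousOn_const
  refine ContinuousOn.div (by fun_prop) (by fun_prop) fun z hz => ?_
  have : 0 < 1 - z ^ 2 := by nlinarith [hz.1, hz.2]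
  positivity

theorem continuous_VTT_left (m g R I₁ I₃ γ σ α lam z : ℝ) :
    Continuous fun D => VTT m g R I₁ I₃ γ σ α lam D z := by
  unfold VTT
  fun_prop

theorem tendsto_VTT_atTop (m g I₁ γ σ α lam D : ℝ) {R I₃ : ℝ} (hR : 0 < R) (hI₃ : 0 < I₃)
    (hγ : 0 < γ) (hD : lam * √(dTT γ σ α 1) + R * D * (α - 1) ≠ 0) :
    Tendsto (VTT m g R I₁ I₃ γ σ α lam D) (𝓝[<] 1) atTop := by
  have hd := continuous_dTT γ σ α
  have hF : ContinuousAt (fun z => lam * √(dTT γ σ α z) + R * D * (α - z)) 1 := by fun_prop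
  have hlin : Tendsto (fun z => m * g * R * (1 - α * z)) (𝓝[<] 1)
      (𝓝 (m * g * R * (1 - α * 1))) :=
    (Continuous.tendsto (by fun_prop) 1).mono_left nhdsWithin_le_nhds
  exact tendsto_atTop_add_const_right _ _
    (hlin.add_atTop (hF.tendsto_sq_div_one_sub_sq hD (by positivity)))

theorem tendsto_VTT_of_eq_zero (m g R I₁ I₃ lam D : ℝ) {γ σ α : ℝ} (hd : dTT γ σ α 1 ≠ 0)
    (hD : lam * √(dTT γ σ α 1) + R * D * (α - 1) = 0) :
    Tendsto (VTT m g R I₁ I₃ γ σ α lam D) (𝓝[<] 1)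
      (𝓝 (m * g * R * (1 - α) + (R ^ 2 * D ^ 2 - σ * lam ^ 2) / (2 * R ^ 2 * I₁))) := by
  have hdd : DifferentiableAt ℝ (dTT γ σ α) 1 := by
    unfold dTT
    fun_prop
  have hF : DifferentiableAt ℝ (fun z => lam * √(dTT γ σ α z) + R * D * (α - z)) 1 := by
    fun_prop (disch := assumption)
  have hlin : Tendsto (fun z => m * g * R * (1 - α * z)) (𝓝[<] 1)
      (𝓝 (m * g * R * (1 - α * 1))) :=
    (Continuous.tendsto (by fun_prop) 1).mono_left nhdsWithin_le_nhds
  have := (hlin.add (hF.hasDerivAt.tendsto_sq_div_one_sub_sq hD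
    (2 * I₃ * R ^ 2 * γ ^ 2))).add_const ((R ^ 2 * D ^ 2 - σ * lam ^ 2) / (2 * R ^ 2 * I₁))
  simp only [mul_one, add_zero] at this
  exact this

/-- Under the rationality conditions `1 − α² < γ < 1`,
`σ = (1−α)/(γ+α²−1)` and for `λ > λ_thres`, for every `ε > 0` there is a
`δm > 0` such that for all `0 < δ < δm` the potential `z ↦ V(z, D, λ)` with
`D = D₁ + δ/(R(1+α)√(γ+α²−1))`, `D₁ = −λ√(d(−1))/(R(1+α))`, has a local
minimum point `z_min ∈ (−1, −1+ε]` on the interval `(−1, 1)`. -/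
theorem stmt_2 (m g R I₁ I₃ α γ σ lam : ℝ)
    (hm : 0 < m) (hg : 0 < g) (hR : 0 < R) (hI₁ : 0 < I₁) (hI₃ : 0 < I₃)
    (hα0 : 0 < α) (hα1 : α < 1)
    (hγ : γ = I₁ / I₃) (hσ : σ = m * R ^ 2 / I₃)
    (hγ1 : 1 - α ^ 2 < γ) (hγ2 : γ < 1)
    (hrat : σ = (1 - α) / (γ + α ^ 2 - 1))
    (hlam : lam > Real.sqrt (m * g * R ^ 3 * α * I₃) * (1 + α) ^ 2
        / Real.sqrt (1 + α - γ)) :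
    ∀ ε > 0, ∃ δp > 0, ∀ δ, 0 < δ → δ < δp →
      ∃ zmin ∈ Set.Ico (1 - ε) (1 : ℝ),
        IsLocalMinOn
          (fun z => VTT m g R I₁ I₃ γ σ α lam
            (lam * Real.sqrt (dTT γ σ α 1) / (R * (1 - α))
              - δ / (R * (1 - α) * Real.sqrt (γ + α ^ 2 - 1))) z)
          (Set.Ioo (-1 : ℝ) 1) zmin := by
  intro ε hε
  have hγ0 : 0 < γ := hγ ▸ div_pos hI₁ hI₃
  have hσ0 : 0 < σ := by rw [hσ]; positivity
  have hk : 0 < √(γ + α ^ 2 - 1) := Real.sqrt_pos.2 (by linarith)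
  have hα : 0 < 1 - α := by linarith
  have hd1 : dTT γ σ α 1 ≠ 0 := by
    unfold dTT
    nlinarith [mul_nonneg hσ0.le (sq_nonneg (α - 1))]
  set D₀ := lam * √(dTT γ σ α 1) / (R * (1 - α)) with hD₀
  set s := R * (1 - α) * √(γ + α ^ 2 - 1)
  have hD₀0 : lam * √(dTT γ σ α 1) + R * D₀ * (α - 1) = 0 := by
    rw [hD₀]
    field_simp
    ring
  obtain ⟨a, ha0, haε, ha1⟩ : ∃ a : ℝ, 0 ≤ a ∧ 1 - ε ≤ a ∧ a < 1 :=
    ⟨max 0 (1 - ε), le_max_left _ _, le_max_right _ _, max_lt one_pos (by linarith)⟩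
  have hVa : m * g * R * (1 - α) + (R ^ 2 * D₀ ^ 2 - σ * lam ^ 2) / (2 * R ^ 2 * I₁)
      < VTT m g R I₁ I₃ γ σ α lam D₀ a := by
    unfold VTT
    have hsq : 0 < 1 - a ^ 2 := by nlinarith
    have hlt : m * g * R * (1 - α) < m * g * R * (1 - α * a) :=
      mul_lt_mul_of_pos_left (by nlinarith) (by positivity)
    have hnn : 0 ≤ (lam * √(dTT γ σ α a) + R * D₀ * (α - a)) ^ 2
        / (2 * I₃ * R ^ 2 * γ ^ 2 * (1 - a ^ 2)) := by positivity
    linarith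
  obtain ⟨b, hVb, hb⟩ := (((tendsto_VTT_of_eq_zero m g R I₁ I₃ lam D₀ hd1 hD₀0).eventually_lt_const
    hVa).and (Ioo_mem_nhdsLT ha1)).exists
  have hev : ∀ᶠ δ in 𝓝[>] (0 : ℝ), VTT m g R I₁ I₃ γ σ α lam (D₀ - δ / s) b
      < VTT m g R I₁ I₃ γ σ α lam (D₀ - δ / s) a := by
    have hcont : ∀ z, Continuous fun δ => VTT m g R I₁ I₃ γ σ α lam (D₀ - δ / s) z := fun z =>
      (continuous_VTT_left m g R I₁ I₃ γ σ α lam z).comp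
        (by fun_prop : Continuous fun δ => D₀ - δ / s)
    exact nhdsWithin_le_nhds ((hcont b).continuousAt.eventually_lt (hcont a).continuousAt
      (by simpa using hVb))
  obtain ⟨δp, hδp, hsub⟩ := mem_nhdsGT_iff_exists_Ioo_subset.1 hev
  refine ⟨δp, hδp, fun δ hδ hδlt => ?_⟩
  have hne : lam * √(dTT γ σ α 1) + R * (D₀ - δ / s) * (α - 1) ≠ 0 := by
    have : lam * √(dTT γ σ α 1) + R * (D₀ - δ / s) * (α - 1) = R * (1 - α) * (δ / s) := by
      linear_combination hD₀0
    rw [this]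
    positivity
  obtain ⟨z, hz, hmin⟩ := exists_isLocalMin_mem_Ioo_of_tendsto_atTop hb
    ((continuousOn_VTT m g I₁ γ σ α lam (D₀ - δ / s) hR hI₃ hγ0).mono
      (Set.Ico_subset_Ico_left ha0))
    (tendsto_VTT_atTop m g I₁ γ σ α lam (D₀ - δ / s) hR hI₃ hγ0 hne) (hsub ⟨hδ, hδlt⟩)
  exact ⟨z, ⟨haε.trans hz.1.le, hz.2⟩, hmin.on _⟩
end

section
/- Let R > 0, 0 < α < 1, I₁ > 0, let ẑ ∈ ℝ³ be a fixed vector, and let L, n, F : ℝ → ℝ³ with L and n differentiable. Set a(t) = R(α n(t) − ẑ). If for all t the equations L′(t) = a(t) × F(t) and n′(t) = (1/I₁)(L(t) × n(t)) hold, then the Jellett function λ(t) = −L(t) · a(t) is constant in t. -/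
open Matrix

theorem HasDerivAt.dotProduct_pi {ι : Type*} [Fintype ι] {u v : ℝ → ι → ℝ} {u' v' : ι → ℝ}
    {t : ℝ} (hu : HasDerivAt u u' t) (hv : HasDerivAt v v' t) :
    HasDerivAt (fun s => u s ⬝ᵥ v s) (u' ⬝ᵥ v t + u t ⬝ᵥ v') t := by
  rw [hasDerivAt_pi] at hu hv
  simp only [dotProduct, ← Finset.sum_add_distrib]
  exact HasDerivAt.fun_sum fun i _ => (hu i).mul (hv i)

/-- For the Tippe Top equations `L′ = a × F`, `n′ = (1/I₁)(L × n)`,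
with `a = R(α n − ẑ)`, the Jellett function `λ(t) = −L(t) · a(t)` is constant. -/
theorem stmt_3 (R α I₁ : ℝ) (hR : 0 < R) (hα0 : 0 < α) (hα1 : α < 1) (hI₁ : 0 < I₁)
    (zhat : Fin 3 → ℝ) (L n F : ℝ → Fin 3 → ℝ)
    (hL : Differentiable ℝ L) (hn : Differentiable ℝ n)
    (a : ℝ → Fin 3 → ℝ) (ha : ∀ t, a t = R • (α • n t - zhat))
    (hLdot : ∀ t, deriv L t = crossProduct (a t) (F t))
    (hndot : ∀ t, deriv n t = (1 / I₁) • crossProduct (L t) (n t)) :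
    ∀ t₁ t₂ : ℝ, -(L t₁ ⬝ᵥ a t₁) = -(L t₂ ⬝ᵥ a t₂) := by
  have key : ∀ t, HasDerivAt (fun s => L s ⬝ᵥ a s) 0 t := by
    intro t
    have hL' := (hL t).hasDerivAt
    have hn' := (hn t).hasDerivAt
    rw [hLdot] at hL'
    rw [hndot] at hn'
    have ha' : HasDerivAt a (R • α • (1 / I₁) • crossProduct (L t) (n t)) t := by
      rw [funext ha]
      exact ((hn'.const_smul α).sub_const zhat).const_smul R
    convert hL'.dotProduct_pi ha' using 1
    rw [dotProduct_comm, dot_self_cross]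
    simp only [dotProduct_smul, dot_self_cross, smul_zero, add_zero]
  intro t₁ t₂
  exact congrArg Neg.neg (is_const_of_deriv_eq_zero (fun t => (key t).differentiableAt)
    (fun t => (key t).deriv) t₁ t₂)
end

section
/- Let m, g, R, g_n, μ > 0 be real parameters with m > 0, let ẑ ∈ ℝ³ be a fixed vector, and let s, L, ω, v_A, a, F : ℝ → ℝ³ be differentiable functions such that for all t: m s″(t) = F(t) − m g ẑ, L′(t) = a(t) × F(t), ω′(t) · L(t) = ω(t) · L′(t), s′(t) = v_A(t) − ω(t) × a(t), v_A(t) · ẑ = 0, and F(t) = g_n(t) ẑ − μ g_n(t) v_A(t) for a real-valued function g_n. Then the total energy E(t) = (1/2) m |s′(t)|² + (1/2) ω(t) · L(t) + m g s(t) · ẑ satisfies E′(t) = −μ g_n(t) |v_A(t)|². -/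
open Matrix

theorem HasDerivAt.vec_dotProduct {n : Type*} [Fintype n] {u v : ℝ → n → ℝ} {u' v' : n → ℝ}
    {t : ℝ} (hu : HasDerivAt u u' t) (hv : HasDerivAt v v' t) :
    HasDerivAt (fun τ => u τ ⬝ᵥ v τ) (u' ⬝ᵥ v t + u t ⬝ᵥ v') t := by
  simp only [dotProduct, ← Finset.sum_add_distrib]
  exact HasDerivAt.fun_sum fun i _ => (hasDerivAt_pi.1 hu i).mul (hasDerivAt_pi.1 hv i)

/-- Energy dissipation law for the rolling and gliding Tippe Top:
from `m s″ = F − m g ẑ`, `L′ = a × F`, `ω′·L = ω·L′`, `s′ = v_A − ω × a`,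
`v_A · ẑ = 0` and `F = g_n ẑ − μ g_n v_A`, the total energy
`E = (1/2)m|s′|² + (1/2)ω·L + m g s·ẑ` satisfies `E′ = −μ g_n |v_A|²`. -/
theorem stmt_4 (m g R μ : ℝ) (hm : 0 < m) (hg : 0 < g) (hR : 0 < R) (hμ : 0 < μ)
    (zhat : Fin 3 → ℝ)
    (s L ω v_A a F : ℝ → Fin 3 → ℝ) (g_n : ℝ → ℝ)
    (hs : Differentiable ℝ s) (hs' : Differentiable ℝ (deriv s))
    (hL : Differentiable ℝ L) (hω : Differentiable ℝ ω)
    (hNewton : ∀ t, m • deriv (deriv s) t = F t - (m * g) • zhat)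
    (hLdot : ∀ t, deriv L t = crossProduct (a t) (F t))
    (hsym : ∀ t, deriv ω t ⬝ᵥ L t = ω t ⬝ᵥ deriv L t)
    (hglide : ∀ t, deriv s t = v_A t - crossProduct (ω t) (a t))
    (hcontact : ∀ t, v_A t ⬝ᵥ zhat = 0)
    (hF : ∀ t, F t = g_n t • zhat - (μ * g_n t) • v_A t) :
    ∀ t, deriv (fun τ => (1 / 2) * m * (deriv s τ ⬝ᵥ deriv s τ)
        + (1 / 2) * (ω τ ⬝ᵥ L τ) + m * g * (s τ ⬝ᵥ zhat)) t
      = -μ * g_n t * (v_A t ⬝ᵥ v_A t) := by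
  intro t
  have hE := ((((hs' t).hasDerivAt.vec_dotProduct (hs' t).hasDerivAt).const_mul
    ((1 / 2) * m)).add (((hω t).hasDerivAt.vec_dotProduct (hL t).hasDerivAt).const_mul
    (1 / 2))).add (((hs t).hasDerivAt.vec_dotProduct (hasDerivAt_const t zhat)).const_mul (m * g))
  refine hE.deriv.trans ?_
  have hkinetic : m * (deriv s t ⬝ᵥ deriv (deriv s) t)
      = deriv s t ⬝ᵥ F t - m * g * (deriv s t ⬝ᵥ zhat) := by
    rw [← smul_eq_mul, ← dotProduct_smul, hNewton, dotProduct_sub, dotProduct_smul, smul_eq_mul]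
  have hrotation : ω t ⬝ᵥ deriv L t = crossProduct (ω t) (a t) ⬝ᵥ F t := by
    rw [hLdot, triple_product_permutation, triple_product_permutation, dotProduct_comm]
  have hpower : deriv s t ⬝ᵥ F t = v_A t ⬝ᵥ F t - crossProduct (ω t) (a t) ⬝ᵥ F t := by
    rw [hglide, sub_dotProduct]
  have hfriction : v_A t ⬝ᵥ F t = -μ * g_n t * (v_A t ⬝ᵥ v_A t) := by
    rw [hF, dotProduct_sub, dotProduct_smul, dotProduct_smul, hcontact]
    simp only [smul_eq_mul]
    ring
  rw [hsym, dotProduct_comm (deriv (deriv s) t), dotProduct_zero]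
  linear_combination hkinetic + hrotation + hpower + hfriction
end

section
/- Let m, g, R, I₁, I₃ be positive reals, 0 < α < 1, γ = I₁/I₃, σ = mR²/I₃. Let θ ∈ (0, π) and let θ̇, φ̇, ω₃ be real numbers. Set z = cos θ, λ = R I₁ φ̇ sin²θ − R I₃ ω₃(α − z), D = I₃ ω₃ √(d(z)), and let Ẽ = (1/2)(I₁ φ̇² sin²θ + I₁ θ̇² + I₃ ω₃²) + mgR(1 − α z) + (1/2) m R² [ (α − z)²(θ̇² + φ̇² sin²θ) + sin²θ (θ̇² + ω₃² + 2 ω₃ φ̇ (α − z)) ]. Then Ẽ = g(z) θ̇² + V(z, D, λ), where g(z) = (1/2) I₃ ( σ((α − z)² + 1 − z²) + γ ) and V(z, D, λ) = mgR(1 − αz) + (λ√(d(z)) + R D (α − z))²/(2 I₃ R² γ² (1 − z²)) + (R²D² − σλ²)/(2R²I₁). -/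
open Real

/-- The effective mass `g(z) = (1/2) I₃ (σ((α−z)² + 1 − z²) + γ)`. -/
noncomputable def gTT (I₃ γ σ α z : ℝ) : ℝ :=
  (1 / 2) * I₃ * (σ * ((α - z) ^ 2 + 1 - z ^ 2) + γ)

/-- the Main Equation for the Tippe Top,
`Ẽ = g(cos θ) θ̇² + V(cos θ, D, λ)`, as an algebraic identity obtained by
eliminating `φ̇` and `ω₃` in favor of Jellett's integral `λ` and the Routh
function `D`. -/
theorem stmt_9 (m g R I₁ I₃ α γ σ : ℝ)
    (hm : 0 < m) (hg : 0 < g) (hR : 0 < R) (hI₁ : 0 < I₁) (hI₃ : 0 < I₃)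
    (hα0 : 0 < α) (hα1 : α < 1)
    (hγ : γ = I₁ / I₃) (hσ : σ = m * R ^ 2 / I₃)
    (θ : ℝ) (hθ : θ ∈ Set.Ioo 0 Real.pi)
    (θdot φdot ω₃ z lam D Etilde : ℝ)
    (hz : z = Real.cos θ)
    (hlam : lam = R * I₁ * φdot * (Real.sin θ) ^ 2 - R * I₃ * ω₃ * (α - z))
    (hD : D = I₃ * ω₃ * Real.sqrt (dTT γ σ α z))
    (hE : Etilde = (1 / 2) * (I₁ * φdot ^ 2 * (Real.sin θ) ^ 2 + I₁ * θdot ^ 2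
          + I₃ * ω₃ ^ 2)
        + m * g * R * (1 - α * z)
        + (1 / 2) * m * R ^ 2 *
          ((α - z) ^ 2 * (θdot ^ 2 + φdot ^ 2 * (Real.sin θ) ^ 2)
            + (Real.sin θ) ^ 2 * (θdot ^ 2 + ω₃ ^ 2 + 2 * ω₃ * φdot * (α - z)))) :
    Etilde = gTT I₃ γ σ α z * θdot ^ 2 + VTT m g R I₁ I₃ γ σ α lam D z := by
  have hsin : 0 < Real.sin θ := Real.sin_pos_of_mem_Ioo hθ
  have hs : 1 - z ^ 2 = Real.sin θ ^ 2 := by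
    rw [hz, Real.sin_sq]
  have hσ0 : 0 < σ := by rw [hσ]; positivity
  have hγ0 : 0 < γ := by rw [hγ]; positivity
  have hd : 0 ≤ dTT γ σ α z := by
    rw [dTT, hs]
    positivity
  have hsq : Real.sqrt (dTT γ σ α z) ^ 2 = dTT γ σ α z := Real.sq_sqrt hd
  have hnum : (lam * Real.sqrt (dTT γ σ α z) + R * D * (α - z)) ^ 2
      = dTT γ σ α z * (R * I₁ * φdot * Real.sin θ ^ 2) ^ 2 := by
    rw [hlam, hD]
    linear_combination (R * I₁ * φdot * Real.sin θ ^ 2) ^ 2 * hsq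
  have hD2 : D ^ 2 = I₃ ^ 2 * ω₃ ^ 2 * dTT γ σ α z := by
    rw [hD, mul_pow, mul_pow, hsq]
  have hg2 : gTT I₃ γ σ α z
      = (1 / 2) * I₃ * (σ * ((α - z) ^ 2 + Real.sin θ ^ 2) + γ) := by
    rw [gTT, ← hs]
    ring
  rw [VTT, hnum, hD2, hg2, dTT, hs, hE, hlam, hγ, hσ]
  field_simp
  ring
end
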